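/- Let k ≥ 1, m ≥ 1, let y, z ∈ ℤ_{≥0}^k, and let a, b ∈ ℤ^k be weakly increasing vectors with 0 ≤ a_i < b_i ≤ m+1 for all i ∈ [k]. Let F be the face of the skew Gelfand–Tsetlin polytope GT_k^m(y,z) obtained by imposing the equalities x_{i,j} = x_{i,j−1} for all i ∈ [k] and all j ∈ [m+1] with j ∉ [a_i + 1, b_i] (with the conventions x_{i,0} = z̃_i and x_{i,m+1} = ỹ_i). Then F is Ehrhart positive: there exists a polynomial p ∈ ℚ[n] with nonnegative coefficients such that p(n) equals the number of integer points of the n-th dilate of F (equivalently, of the face of GT_k^m(ny,nz) cut out by the same equalities) for all integers n ≥ 1. -/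

import Mathlib

/-- The entries of a Gelfand–Tsetlin pattern extended by the boundary conditions
`x_{i,0} = zt i` and `x_{i,m+1} = yt i`. -/
def gtExt (k m : ℕ) (zt yt : Fin k → ℤ) (x : Fin k → Fin m → ℤ)
    (i : Fin k) (j : Fin (m + 2)) : ℤ :=
  if h0 : (j : ℕ) = 0 then zt i
  else if h1 : (j : ℕ) = m + 1 then yt i
  else x i ⟨(j : ℕ) - 1, by have := j.isLt; omega⟩

/-- The defining inequalities `x_{i,j} ≤ x_{i,j+1} ≤ x_{i+1,j}` (for all meaningful
indices `i ∈ [k]`, `0 ≤ j ≤ m`) of the skew Gelfand–Tsetlin polytope, with the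
conventions `x_{i,0} = zt i` and `x_{i,m+1} = yt i`. -/
def gtCond (k m : ℕ) (zt yt : Fin k → ℤ) (x : Fin k → Fin m → ℤ) : Prop :=
  (∀ (i : Fin k) (j : Fin (m + 1)),
    gtExt k m zt yt x i j.castSucc ≤ gtExt k m zt yt x i j.succ) ∧
  (∀ (i : Fin k) (hi : (i : ℕ) + 1 < k) (j : Fin (m + 1)),
    gtExt k m zt yt x i j.succ ≤ gtExt k m zt yt x ⟨(i : ℕ) + 1, hi⟩ j.castSucc)

section Helpers
open Polynomial

noncomputable def hPoly (r : ℤ) : ℚ[X] :=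
  if r < 0 then 0 else C (1 / (r.toNat.factorial : ℚ)) * ascPochhammer ℚ r.toNat

lemma hPoly_neg {r : ℤ} (h : r < 0) : hPoly r = 0 := by simp [hPoly, h]

lemma hPoly_nat (r : ℕ) : hPoly r = C (1 / (r.factorial : ℚ)) * ascPochhammer ℚ r := by
  simp [hPoly]

lemma hPoly_zero : hPoly 0 = 1 := by
  have := hPoly_nat 0
  simpa using this

lemma hPoly_pascal (r : ℤ) (x : ℚ) :
    (hPoly r).eval (x + 1) - (hPoly (r - 1)).eval (x + 1) = (hPoly r).eval x := by
  rcases lt_trichotomy r 0 with h | h | h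
  · rw [hPoly_neg h, hPoly_neg (by omega : r - 1 < 0)]; simp
  · subst h
    rw [hPoly_zero, hPoly_neg (by omega)]; simp
  · obtain ⟨t, rfl⟩ : ∃ t : ℕ, r = ((t + 1 : ℕ) : ℤ) := ⟨(r - 1).toNat, by omega⟩
    have e : (((t + 1 : ℕ) : ℤ) - 1) = (t : ℤ) := by push_cast; ring
    rw [e, hPoly_nat, hPoly_nat]
    have h1 := ascPochhammer_succ_eval (S := ℚ) t (x + 1)
    have h2 : (ascPochhammer ℚ (t + 1)).eval x = x * (ascPochhammer ℚ t).eval (x + 1) := by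
      rw [ascPochhammer_succ_left]; simp [eval_comp]
    simp only [eval_mul, eval_C, h1, h2, Nat.factorial_succ]
    have : (t.factorial : ℚ) ≠ 0 := by positivity
    push_cast
    field_simp
    ring

noncomputable def krewMat {q : ℕ} (I J : Fin q → ℤ) : Matrix (Fin q) (Fin q) ℚ[X] :=
  Matrix.of fun s t => (hPoly (J s - I t)).comp (X + C ((s : ℚ) - (t : ℚ)))

noncomputable def krewDet {q : ℕ} (I J : Fin q → ℤ) : ℚ[X] := (krewMat I J).det

/-- strictly decreasing sequences bounded below by `L` and above by `J` -/
noncomputable def antiSeqs (q : ℕ) (L : ℤ) (J : Fin q → ℤ) : Finset (Fin q → ℤ) :=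
  open Classical in (Fintype.piFinset fun s => Finset.Icc L (J s)).filter StrictAnti

lemma mem_antiSeqs {q : ℕ} {L : ℤ} {J x : Fin q → ℤ} :
    x ∈ antiSeqs q L J ↔ (∀ s, L ≤ x s ∧ x s ≤ J s) ∧ StrictAnti x := by
  simp [antiSeqs]

lemma sum_telescope {V : Type*} [AddCommGroup V] (f g : ℤ → V)
    (h : ∀ j, g j - g (j - 1) = f j) (u : ℤ) (d : ℕ) :
    ∑ j ∈ Finset.Icc (u + 1) (u + d), f j = g (u + d) - g u := by
  induction d with
  | zero => simp
  | succ d ih =>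
    have : Finset.Icc (u + 1) (u + ((d + 1 : ℕ) : ℤ))
        = insert (u + ((d + 1 : ℕ) : ℤ)) (Finset.Icc (u + 1) (u + d)) := by
      ext w; simp only [Finset.mem_Icc, Finset.mem_insert]; push_cast; omega
    rw [this, Finset.sum_insert (by simp), ih, ← h]
    have e : u + ((d + 1 : ℕ) : ℤ) - 1 = u + d := by push_cast; ring
    rw [e]; abel

lemma sa_vecCons {q : ℕ} (a : ℤ) (v : Fin q → ℤ) :
    StrictAnti (Matrix.vecCons a v) ↔ (∀ s, v s < a) ∧ StrictAnti v := by
  constructor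
  · intro h
    refine ⟨fun s => ?_, fun s t hst => ?_⟩
    · have := h (Fin.succ_pos s); simpa using this
    · have := h (Fin.succ_lt_succ_iff.2 hst); simpa using this
  · rintro ⟨h1, h2⟩ s t hst
    induction s using Fin.cases with
    | zero =>
      induction t using Fin.cases with
      | zero => exact absurd hst (lt_irrefl _)
      | succ t => simpa using h1 t
    | succ s =>
      induction t using Fin.cases with
      | zero => exact absurd hst (by simp)
      | succ t => simpa using h2 (Fin.succ_lt_succ_iff.1 hst)

lemma alt_sum {V : Type*} [AddCommGroup V] [Module ℚ V] (L : ℤ) :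
    ∀ (q : ℕ) (φ : V [⋀^Fin q]→ₗ[ℚ] ℚ) (g : ℕ → ℤ → V)
      (_ : ∀ s j, g (s + 1) j - g (s + 1) (j - 1) = g s j)
      (_ : ∀ s j, j < L → g s j = 0)
      (J : Fin q → ℤ) (_ : StrictAnti J) (_ : ∀ s, L ≤ J s),
      ∑ x ∈ antiSeqs q L J, φ (fun s => g s (x s)) = φ (fun s => g (s + 1) (J s)) := by
  intro q
  induction q with
  | zero =>
    intro φ g _ _ J _ _
    have : antiSeqs 0 L J = {J} := by
      ext x
      simp only [mem_antiSeqs, Finset.mem_singleton]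
      constructor
      · intro _; exact Subsingleton.elim _ _
      · rintro rfl; exact ⟨fun s => s.elim0, fun s => s.elim0⟩
    rw [this, Finset.sum_singleton]
    congr 1
    exact Subsingleton.elim _ _
  | succ q ih =>
    intro φ g hg h0 J hJ hL
    -- lower bound for the first coordinate
    let low : (Fin q → ℤ) → ℤ := fun v => if h : 0 < q then v ⟨0, h⟩ else L - 1
    have hJt : StrictAnti (fun s : Fin q => J s.succ) := fun s t hst =>
      hJ (Fin.succ_lt_succ_iff.2 hst)
    have key : ∑ x ∈ antiSeqs (q + 1) L J, φ (fun s => g s (x s)) =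
        ∑ v ∈ antiSeqs q L (fun s => J s.succ),
          ∑ j ∈ Finset.Icc (low v + 1) (J 0),
            φ (Matrix.vecCons (g 0 j) (fun s => g (s + 1) (v s))) := by
      rw [Finset.sum_sigma']
      refine Finset.sum_bij' (fun x _ => ⟨fun s => x s.succ, x 0⟩)
        (fun p _ => Matrix.vecCons p.2 p.1) ?_ ?_ ?_ ?_ ?_
      · intro x hx
        rw [mem_antiSeqs] at hx
        simp only [Finset.mem_sigma, mem_antiSeqs, Finset.mem_Icc]
        refine ⟨⟨fun s => hx.1 s.succ, fun s t hst => hx.2 (Fin.succ_lt_succ_iff.2 hst)⟩, ?_,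
          (hx.1 0).2⟩
        by_cases h : 0 < q
        · simp only [low, h, dif_pos]
          have := hx.2 (Fin.succ_pos ⟨0, h⟩)
          omega
        · simp only [low, h]
          have := (hx.1 0).1
          simpa using this
      · rintro ⟨v, j⟩ hp
        simp only [Finset.mem_sigma, mem_antiSeqs, Finset.mem_Icc] at hp
        obtain ⟨⟨h1, h2⟩, h3, h4⟩ := hp
        rw [mem_antiSeqs, sa_vecCons]
        have h5 : L ≤ j := by
          by_cases h : 0 < q
          · simp only [low, h, dif_pos] at h3
            have := (h1 ⟨0, h⟩).1
            omega
          · simpa [low, h] using h3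
        refine ⟨fun s => ?_, fun s => ?_, h2⟩
        · induction s using Fin.cases with
          | zero => exact ⟨h5, h4⟩
          | succ s => exact h1 s
        · have h : 0 < q := s.pos
          simp only [low, h, dif_pos] at h3
          have : v s ≤ v ⟨0, h⟩ := h2.antitone (Fin.mk_le_of_le_val (by simp))
          show v s < j
          omega
      · intro x hx
        ext s
        induction s using Fin.cases <;> simp
      · rintro ⟨v, j⟩ hp
        simp
      · intro x hx
        congr 1
        ext s
        induction s using Fin.cases <;> simp
    rw [key]
    have inner : ∀ v ∈ antiSeqs q L (fun s => J s.succ),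
        ∑ j ∈ Finset.Icc (low v + 1) (J 0),
            φ (Matrix.vecCons (g 0 j) (fun s => g (s + 1) (v s)))
          = φ.curryLeft (g 1 (J 0)) (fun s => g (s + 1) (v s)) := by
      intro v hv
      rw [mem_antiSeqs] at hv
      have hle : low v ≤ J 0 := by
        by_cases h : 0 < q
        · simp only [low, h, dif_pos]
          have := (hv.1 ⟨0, h⟩).2
          have := hJ (Fin.succ_pos ⟨0, h⟩)
          omega
        · simp only [low, h]
          have := hL 0
          simp; omega
      obtain ⟨d, hd⟩ := Int.le.dest hle
      have tel := sum_telescope (g 0) (g 1) (hg 0) (low v) d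
      rw [hd] at tel
      simp only [← AlternatingMap.curryLeft_apply_apply]
      have e1 : ∑ j ∈ Finset.Icc (low v + 1) (J 0),
            φ.curryLeft (g 0 j) (fun s => g (s + 1) (v s))
          = φ.curryLeft (∑ j ∈ Finset.Icc (low v + 1) (J 0), g 0 j)
              (fun s => g (s + 1) (v s)) := by
        let ev : V →+ ℚ :=
          { toFun := fun w => φ.curryLeft w (fun s => g (s + 1) (v s))
            map_zero' := by simp
            map_add' := fun w w' => by rw [map_add, AlternatingMap.add_apply] }
        exact (map_sum ev _ _).symm
      rw [e1, tel, map_sub, AlternatingMap.sub_apply, sub_eq_self]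
      by_cases h : 0 < q
      · rw [AlternatingMap.curryLeft_apply_apply]
        refine φ.map_eq_zero_of_eq _ (i := 0) (j := Fin.succ ⟨0, h⟩) ?_ ?_
        · simp [low, h]
        · exact (Fin.succ_pos _).ne
      · have : low v = L - 1 := by simp [low, h]
        rw [this, h0 1 (L - 1) (by omega)]
        simp
    rw [Finset.sum_congr rfl inner,
      ih (φ.curryLeft (g 1 (J 0))) (fun s => g (s + 1)) (fun s j => hg (s + 1) j)
        (fun s j hj => h0 (s + 1) j hj) (fun s => J s.succ) hJt (fun s => hL s.succ),
      AlternatingMap.curryLeft_apply_apply]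
    congr 1
    ext s
    induction s using Fin.cases <;> simp

lemma krewDet_eval {q : ℕ} (I J : Fin q → ℤ) (x : ℚ) :
    (krewDet I J).eval x =
      (Matrix.of fun s t : Fin q =>
        (hPoly (J s - I t)).eval (x + ((s : ℚ) - (t : ℚ)))).det := by
  rw [krewDet, ← coe_evalRingHom, RingHom.map_det]
  congr 1
  ext s t
  simp [krewMat, eval_comp]

lemma krewDet_sum {q : ℕ} (L : ℤ) (I J : Fin q → ℤ) (hJ : StrictAnti J)
    (hI : ∀ s, L ≤ I s) (hL : ∀ s, L ≤ J s) (x : ℚ) :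
    ∑ K ∈ antiSeqs q L J, (krewDet I K).eval x = (krewDet I J).eval (x + 1) := by
  have := alt_sum L q (Matrix.detRowAlternating (n := Fin q) (R := ℚ))
    (fun s j t => (hPoly (j - I t)).eval (x + ((s : ℚ) - (t : ℚ))))
    (by
      intro s j
      funext t
      have := hPoly_pascal (j - I t) (x + ((s : ℚ) - (t : ℚ)))
      simp only [Pi.sub_apply]
      rw [← this]
      have e1 : x + (((s + 1 : ℕ) : ℚ) - (t : ℚ)) = x + ((s : ℚ) - (t : ℚ)) + 1 := by
        push_cast; ring
      have e2 : j - 1 - I t = j - I t - 1 := by ring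
      rw [e1, e2])
    (by
      intro s j hj
      funext t
      have := hI t
      simp only [Pi.zero_apply]
      rw [hPoly_neg (by omega)]; simp) J hJ hL
  simp only [krewDet_eval]
  refine Eq.trans this ?_
  show Matrix.det _ = _
  congr 1
  ext s t
  simp only [Matrix.of_apply]
  congr 1
  push_cast; ring


lemma krewDet_split {p r : ℕ} (I J : Fin (p + r) → ℤ)
    (h : ∀ (s : Fin r) (t : Fin p), J (Fin.natAdd p s) < I (Fin.castAdd r t)) :
    krewDet I J = krewDet (fun s => I (Fin.castAdd r s)) (fun s => J (Fin.castAdd r s)) *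
      krewDet (fun s => I (Fin.natAdd p s)) (fun s => J (Fin.natAdd p s)) := by
  unfold krewDet
  rw [← Matrix.det_submatrix_equiv_self finSumFinEquiv (krewMat I J),
    ← Matrix.det_fromBlocks_zero₂₁ _
      (Matrix.of fun (s : Fin p) (t : Fin r) => krewMat I J (Fin.castAdd r s) (Fin.natAdd p t))]
  congr 1
  ext s t : 2
  rcases s with s | s <;> rcases t with t | t
  · simp [krewMat]
  · simp
  · simp only [Matrix.submatrix_apply, finSumFinEquiv_apply_left, finSumFinEquiv_apply_right,
      Matrix.fromBlocks_apply₂₁, krewMat, Matrix.of_apply, Matrix.zero_apply]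
    rw [hPoly_neg (by have := h s t; omega)]
    simp
  · simp [krewMat]

lemma anti_gap {q : ℕ} {J : Fin q → ℤ} (hJ : StrictAnti J) {s t : Fin q} (hst : s ≤ t) :
    J t + ((t : ℤ) - (s : ℤ)) ≤ J s := by
  obtain ⟨s, hs⟩ := s
  obtain ⟨t, ht⟩ := t
  have hst' : s ≤ t := hst
  obtain ⟨d, rfl⟩ := Nat.exists_eq_add_of_le hst'
  clear hst hst'
  induction d with
  | zero => simp
  | succ d ih =>
    have h1 := ih (by omega)
    have h2 : J ⟨s + (d + 1), ht⟩ < J ⟨s + d, by omega⟩ := hJ (by simp [Fin.lt_def])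
    simp only at h1 ⊢
    push_cast at h1 ⊢
    linarith

lemma hPoly_shift (d e : ℕ) :
    ∃ Q : ℚ[X], (hPoly ((d + 1 + e : ℕ) : ℤ)).comp (X + C (-(d : ℚ))) = X * Q ∧
      0 ≤ (-1) ^ d * Q.eval 0 := by
  refine ⟨C (1 / ((d + 1 + e).factorial : ℚ)) * ((ascPochhammer ℚ d).comp (X + C (-(d : ℚ))) *
    (ascPochhammer ℚ e).comp (X + 1)), ?_, ?_⟩
  · rw [hPoly_nat]
    have h1 := ascPochhammer_mul ℚ d (e + 1)
    have e1 : d + 1 + e = d + (e + 1) := by ring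
    rw [e1, ← h1, ascPochhammer_succ_left]
    simp only [mul_comp, comp_assoc, C_comp, add_comp, X_comp, natCast_comp, one_comp]
    have e2 : X + C (-(d : ℚ)) + (d : ℚ[X]) = X := by
      simp
    rw [e2]
    ring
  · simp only [eval_mul, eval_C, eval_comp, eval_add, eval_X, eval_one, zero_add]
    rw [ascPochhammer_eval_neg_eq_descPochhammer]
    have h1 : 0 ≤ (descPochhammer ℚ d).eval (d : ℚ) := by
      rw [descPochhammer_eval_eq_descFactorial]; positivity
    have h2 : 0 ≤ (ascPochhammer ℚ e).eval (1 : ℚ) := by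
      exact (ascPochhammer_pos e (1 : ℚ) one_pos).le
    have h3 : ((-1 : ℚ)) ^ d * (-1) ^ d = 1 := by rw [← mul_pow]; simp
    have : (-1 : ℚ) ^ d * (1 / ((d + 1 + e).factorial : ℚ) * ((-1) ^ d *
        (descPochhammer ℚ d).eval (d : ℚ) * (ascPochhammer ℚ e).eval 1)) =
        ((-1) ^ d * (-1) ^ d) * (1 / ((d + 1 + e).factorial : ℚ) *
        ((descPochhammer ℚ d).eval (d : ℚ) * (ascPochhammer ℚ e).eval 1)) := by ring
    rw [this, h3]
    positivity

lemma hPoly_eval_one (r : ℕ) : (hPoly r).eval 1 = 1 := by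
  rw [hPoly_nat]
  simp only [eval_mul, eval_C]
  rw [ascPochhammer_eval_one]
  have : (r.factorial : ℚ) ≠ 0 := by positivity
  field_simp

lemma krewMat_shift {q : ℕ} (I J : Fin q → ℤ) (hJ : StrictAnti J)
    (hlt : ∀ s, I s < J s) {s t : Fin q} (hst : s ≤ t) :
    ∃ Q : ℚ[X], krewMat I J s t = X * Q ∧ 0 ≤ (-1) ^ ((t : ℕ) - (s : ℕ)) * Q.eval 0 := by
  have h1 := anti_gap hJ hst
  have h2 := hlt t
  have hst' : (s : ℕ) ≤ t := hst
  obtain ⟨Q, hQ, hs⟩ := hPoly_shift ((t : ℕ) - (s : ℕ))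
    (J s - I t - ((t : ℤ) - (s : ℤ)) - 1).toNat
  refine ⟨Q, ?_, hs⟩
  rw [← hQ]
  simp only [krewMat, Matrix.of_apply]
  congr 2
  · push_cast [hst']
    omega
  · push_cast [hst']
    congr 1
    ring

lemma krew_connected {q : ℕ} (I J : Fin (q + 1) → ℤ) (hJ : StrictAnti J)
    (hlt : ∀ s, I s < J s) (hc : ∀ s : Fin q, I s.castSucc ≤ J s.succ) :
    (krewDet I J).coeff 0 = 0 ∧ 0 ≤ (krewDet I J).coeff 1 := by
  choose Q hQ hs using fun t : Fin (q + 1) => krewMat_shift I J hJ hlt (Fin.zero_le t)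
  have hM : krewMat I J = (krewMat I J).updateRow 0 ((X : ℚ[X]) • Q) := by
    have : (X : ℚ[X]) • Q = krewMat I J 0 := by
      funext t; rw [hQ t]; rfl
    rw [this, Matrix.updateRow_eq_self]
  have hdet : krewDet I J = X * ((krewMat I J).updateRow 0 Q).det := by
    rw [krewDet, hM, Matrix.det_updateRow_smul, Matrix.updateRow_idem]
  rw [hdet]
  refine ⟨by simp, ?_⟩
  have hx1 : ∀ P : ℚ[X], (X * P).coeff 1 = P.coeff 0 := fun P => coeff_X_mul P 0
  rw [hx1, coeff_zero_eq_eval_zero, ← coe_evalRingHom,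
    RingHom.map_det, Matrix.det_succ_row_zero]
  rw [Finset.sum_eq_single (Fin.last q)]
  · have hdiag : ((((evalRingHom (0 : ℚ)).mapMatrix ((krewMat I J).updateRow 0 Q))).submatrix
        Fin.succ (Fin.last q).succAbove).det = 1 := by
      rw [Matrix.det_of_isLowerTriangular]
      · apply Finset.prod_eq_one
        intro s _
        have hr := hc s
        obtain ⟨r, hr'⟩ := Int.le.dest hr
        have : J s.succ - I s.castSucc = (r : ℤ) := by omega
        simp [krewMat, Matrix.updateRow_apply, eval_comp, this, hPoly_eval_one]
      · intro s t hst
        have hst' : s < t := hst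
        obtain ⟨Q', hQ', -⟩ := krewMat_shift I J hJ hlt (s := s.succ) (t := t.castSucc)
          (by simp only [Fin.le_def, Fin.val_succ, Fin.val_castSucc]; exact hst')
        simp [Matrix.updateRow_apply, hQ']
    rw [hdiag, mul_one]
    have := hs (Fin.last q)
    simpa using this
  · intro t _ ht
    have : ((((evalRingHom (0 : ℚ)).mapMatrix ((krewMat I J).updateRow 0 Q))).submatrix
        Fin.succ t.succAbove).det = 0 := by
      have htl : t < Fin.last q := lt_of_le_of_ne (Fin.le_last t) ht
      have hq : 0 < q := by
        have : (t : ℕ) < q := htl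
        omega
      apply Matrix.det_eq_zero_of_column_eq_zero ⟨q - 1, by omega⟩
      intro s
      have e : t.succAbove ⟨q - 1, by omega⟩ = Fin.last q := by
        have : (t : ℕ) < q := htl
        rw [Fin.succAbove_of_le_castSucc]
        · ext; simp; omega
        · simp only [Fin.le_def, Fin.val_castSucc]; omega
      obtain ⟨Q', hQ', -⟩ := krewMat_shift I J hJ hlt (s := s.succ) (t := Fin.last q)
          (Fin.le_last _)
      simp [Matrix.updateRow_apply, e, hQ']
    rw [this, mul_zero]
  · simp

lemma krew_struct : ∀ (q : ℕ) (I J : Fin q → ℤ), StrictAnti I → StrictAnti J →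
    (krewDet I J).coeff 0 = (if I = J then 1 else 0) ∧ 0 ≤ (krewDet I J).coeff 1 := by
  intro q
  induction q using Nat.strong_induction_on with
  | _ q ih =>
  intro I J hI hJ
  rcases q with _ | q
  · have : I = J := Subsingleton.elim _ _
    simp [this, krewDet, coeff_one]
  by_cases hlast : J (Fin.last q) < I (Fin.last q)
  · have h0 : krewDet I J = 0 := by
      apply Matrix.det_eq_zero_of_row_eq_zero (Fin.last q)
      intro t
      simp only [krewMat, Matrix.of_apply]
      have := hI.antitone (Fin.le_last t)
      rw [hPoly_neg (by omega)]; simp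
    have : I ≠ J := by rintro rfl; exact lt_irrefl _ hlast
    simp [h0, this]
  by_cases hsp : ∃ s : Fin q, J s.succ < I s.castSucc
  · obtain ⟨⟨s0, hlt⟩, hs0⟩ := hsp
    obtain ⟨r, rfl⟩ : ∃ r, q = s0 + 1 + r := ⟨q - s0 - 1, by omega⟩
    have hspl := krewDet_split (p := s0 + 1) (r := r + 1) I J (by
      intro s t
      have h1 : J (Fin.natAdd (s0 + 1) s) ≤ J (Fin.succ ⟨s0, hlt⟩) :=
        hJ.antitone (by simp [Fin.le_def])
      have h2 : I (Fin.castSucc ⟨s0, hlt⟩) ≤ I (Fin.castAdd (r + 1) t) :=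
        hI.antitone (by simp only [Fin.le_def, Fin.val_castAdd, Fin.val_castSucc]; omega)
      exact h1.trans_lt (hs0.trans_le h2))
    have hA := ih (s0 + 1) (by omega) (fun s => I (Fin.castAdd (r + 1) s))
      (fun s => J (Fin.castAdd (r + 1) s))
      (fun s t hst => hI hst) (fun s t hst => hJ hst)
    have hB := ih (r + 1) (by omega) (fun s => I (Fin.natAdd (s0 + 1) s))
      (fun s => J (Fin.natAdd (s0 + 1) s))
      (fun s t hst => hI (Nat.add_lt_add_left hst (s0 + 1)))
      (fun s t hst => hJ (Nat.add_lt_add_left hst (s0 + 1)))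
    have hiff : I = J ↔ ((fun s => I (Fin.castAdd (r + 1) s)) = (fun s => J (Fin.castAdd (r + 1) s))
        ∧ (fun s : Fin (r + 1) => I (Fin.natAdd (s0 + 1) s)) = (fun s : Fin (r + 1) => J (Fin.natAdd (s0 + 1) s))) := by
      constructor
      · rintro rfl; exact ⟨rfl, rfl⟩
      · rintro ⟨h1, h2⟩
        funext s
        exact Fin.addCases (m := s0 + 1) (n := r + 1) (motive := fun s => I s = J s)
          (fun s => congrFun h1 s) (fun s => congrFun h2 s) s
    have hc0 : ∀ P : Prop, [Decidable P] → (0 : ℚ) ≤ if P then 1 else 0 := by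
      intro P _; split_ifs <;> norm_num
    rw [hspl]
    constructor
    · rw [mul_coeff_zero, hA.1, hB.1]
      simp only [hiff, ite_and]
      split_ifs <;> simp
    · rw [mul_coeff_one, hA.1, hB.1]
      exact add_nonneg (mul_nonneg (hc0 _) hB.2) (mul_nonneg hA.2 (hc0 _))
  · push Not at hsp
    by_cases hall : ∀ s, I s < J s
    · have := krew_connected I J hJ hall hsp
      have hne : I ≠ J := by rintro rfl; exact lt_irrefl _ (hall 0)
      simp [this, hne]
    · rcases q with _ | q
      · push Not at hall
        obtain ⟨s, hs⟩ := hall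
        have hs0 : s = 0 := Fin.fin_one_eq_zero s
        subst hs0
        have : I 0 = J 0 := le_antisymm (not_lt.1 hlast) hs
        have hIJ : I = J := by funext s; rw [Fin.fin_one_eq_zero s, this]
        subst hIJ
        simp [krewDet, krewMat, hPoly_zero, coeff_one]
      · exfalso
        apply hall
        intro s
        induction s using Fin.cases with
        | zero =>
          have h1 := hsp 0
          have h2 := hJ (Fin.succ_pos (0 : Fin (q + 1)))
          have : (Fin.castSucc (0 : Fin (q + 1))) = 0 := rfl
          rw [this] at h1
          omega
        | succ s =>
          have h1 := hsp s
          have h2 := hI (Fin.castSucc_lt_succ (i := s))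
          omega


abbrev Col (k : ℕ) (lo hi : ℤ) : Type := ↥(antiSeqs k lo (fun _ => hi))

open Classical in
noncomputable def zetaMat (k : ℕ) (lo hi : ℤ) : Matrix (Col k lo hi) (Col k lo hi) ℚ :=
  Matrix.of fun e f => if e.1 ≤ f.1 then 1 else 0

lemma zetaMat_pow (k : ℕ) (lo hi : ℤ) (n : ℕ) (I J : Col k lo hi) :
    (zetaMat k lo hi ^ n) I J = (krewDet I.1 J.1).eval (n : ℚ) := by
  classical
  induction n generalizing J with
  | zero =>
    have hI := mem_antiSeqs.1 I.2
    have hJ := mem_antiSeqs.1 J.2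
    have := (krew_struct k I.1 J.1 hI.2 hJ.2).1
    rw [pow_zero, Nat.cast_zero, ← coeff_zero_eq_eval_zero, this, Matrix.one_apply]
    simp only [Subtype.ext_iff]
  | succ n ih =>
    have hI := mem_antiSeqs.1 I.2
    have hJ := mem_antiSeqs.1 J.2
    rw [pow_succ, Matrix.mul_apply]
    simp only [ih]
    push_cast
    rw [← krewDet_sum lo I.1 J.1 hJ.2 (fun s => (hI.1 s).1) (fun s => (hJ.1 s).1)]
    have hset : antiSeqs k lo J.1 = (antiSeqs k lo (fun _ => hi)).filter (fun K => K ≤ J.1) := by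
      ext K
      simp only [Finset.mem_filter, mem_antiSeqs]
      constructor
      · rintro ⟨h1, h2⟩
        exact ⟨⟨fun s => ⟨(h1 s).1, (h1 s).2.trans (hJ.1 s).2⟩, h2⟩, fun s => (h1 s).2⟩
      · rintro ⟨⟨h1, h2⟩, h3⟩
        exact ⟨fun s => ⟨(h1 s).1, h3 s⟩, h2⟩
    rw [hset, Finset.sum_filter, ← Finset.sum_coe_sort (antiSeqs k lo (fun _ => hi))
      (fun K => if K ≤ J.1 then (krewDet I.1 K).eval (n : ℚ) else 0)]
    apply Finset.sum_congr rfl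
    intro K _
    simp [zetaMat]

lemma poly_eq_of_nat {P Q : ℚ[X]} (h : ∀ n : ℕ, P.eval (n : ℚ) = Q.eval (n : ℚ)) : P = Q := by
  apply Polynomial.eq_of_infinite_eval_eq
  apply Set.Infinite.mono (s := Set.range (fun n : ℕ => (n : ℚ)))
  · rintro _ ⟨n, rfl⟩; exact h n
  · exact Set.infinite_range_of_injective Nat.cast_injective

lemma krewDet_derivative (k : ℕ) (lo hi : ℤ) (I J : Col k lo hi) :
    derivative (krewDet I.1 J.1) =
      ∑ K : Col k lo hi, C ((krewDet K.1 J.1).coeff 1) * krewDet I.1 K.1 := by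
  apply poly_eq_of_nat
  intro n
  have h1 : (krewDet I.1 J.1).comp (X + C (n : ℚ)) =
      ∑ K : Col k lo hi, C ((krewDet I.1 K.1).eval (n : ℚ)) * krewDet K.1 J.1 := by
    apply poly_eq_of_nat
    intro l
    simp only [eval_comp, eval_add, eval_X, eval_C, eval_finsetSum, eval_mul]
    have := zetaMat_pow k lo hi (n + l) I J
    rw [pow_add, Matrix.mul_apply] at this
    simp only [zetaMat_pow] at this
    rw [this]
    congr 1
    push_cast; ring
  have h2 := congrArg (fun P : ℚ[X] => (derivative P).eval 0) h1
  simp only [derivative_comp, derivative_sum, derivative_mul, eval_finsetSum] at h2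
  simp only [derivative_add, derivative_X, derivative_C, add_zero, one_mul, zero_mul, zero_add,
    eval_mul, eval_C, eval_comp, eval_add, eval_X] at h2
  rw [h2, eval_finsetSum]
  apply Finset.sum_congr rfl
  intro K _
  rw [eval_mul, eval_C, ← coeff_zero_eq_eval_zero (derivative _), coeff_derivative]
  simp
  ring

lemma krewDet_coeff_nonneg (k : ℕ) (lo hi : ℤ) (j : ℕ) (I J : Col k lo hi) :
    0 ≤ (krewDet I.1 J.1).coeff j := by
  induction j generalizing J with
  | zero =>
    have := (krew_struct k I.1 J.1 (mem_antiSeqs.1 I.2).2 (mem_antiSeqs.1 J.2).2).1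
    rw [this]
    split_ifs <;> norm_num
  | succ j ih =>
    have h := congrArg (fun P : ℚ[X] => P.coeff j) (krewDet_derivative k lo hi I J)
    simp only [coeff_derivative, finsetSum_coeff, coeff_C_mul] at h
    have h2 : 0 ≤ ∑ K : Col k lo hi, (krewDet K.1 J.1).coeff 1 * (krewDet I.1 K.1).coeff j :=
      Finset.sum_nonneg fun K _ => mul_nonneg
        (krew_struct k K.1 J.1 (mem_antiSeqs.1 K.2).2 (mem_antiSeqs.1 J.2).2).2 (ih K)
    rw [← h] at h2
    have h3 : (0 : ℚ) < (j : ℚ) + 1 := by positivity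
    exact nonneg_of_mul_nonneg_left h2 h3


open Classical in
noncomputable def stepMat {k : ℕ} {lo hi : ℤ} (B : Col k lo hi → Prop) :
    Matrix (Col k lo hi) (Col k lo hi) ℚ :=
  Matrix.of fun e f => if B e ∧ e ≤ f then 1 else 0

lemma zetaMat_pow_eq_zero {k : ℕ} {lo hi : ℤ} (n : ℕ) (I J : Col k lo hi) (h : ¬ I ≤ J) :
    (zetaMat k lo hi ^ n) I J = 0 := by
  classical
  induction n generalizing J with
  | zero =>
    rw [pow_zero, Matrix.one_apply, if_neg]
    rintro rfl; exact h le_rfl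
  | succ n ih =>
    rw [pow_succ, Matrix.mul_apply]
    apply Finset.sum_eq_zero
    intro K _
    by_cases hK : I ≤ K
    · have : ¬ K.1 ≤ J.1 := fun hKJ => h (hK.trans hKJ)
      have h0 : zetaMat k lo hi K J = 0 := by
        simp only [zetaMat, Matrix.of_apply]; rw [if_neg this]
      rw [h0, mul_zero]
    · rw [ih K hK, zero_mul]

/-- A box of columns -/
def inBox {k : ℕ} {lo hi : ℤ} (l u : Fin k → ℤ) (e : Col k lo hi) : Prop :=
  ∀ i, l i ≤ e.1 i ∧ e.1 i ≤ u i

lemma stepMat_pow_mem {k : ℕ} {lo hi : ℤ} (l u : Fin k → ℤ) (n : ℕ) (I J : Col k lo hi)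
    (hI : inBox l u I) (hJ : inBox l u J) :
    (stepMat (inBox l u) ^ n) I J = (zetaMat k lo hi ^ n) I J := by
  classical
  induction n generalizing J with
  | zero => simp
  | succ n ih =>
    rw [pow_succ, pow_succ, Matrix.mul_apply, Matrix.mul_apply]
    apply Finset.sum_congr rfl
    intro K _
    by_cases hKJ : K ≤ J
    · have hKJ' : K.1 ≤ J.1 := hKJ
      by_cases hK : inBox l u K
      · rw [ih K hK]
        simp [stepMat, zetaMat, hK, hKJ]
      · have hIK : ¬ I ≤ K := by
          intro hIK
          exact hK fun i => ⟨(hI i).1.trans (hIK i), (hKJ i).trans (hJ i).2⟩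
        rw [zetaMat_pow_eq_zero n I K hIK]
        simp [stepMat, hK]
    · have hKJ' : ¬ K.1 ≤ J.1 := hKJ
      simp [stepMat, zetaMat, hKJ]

lemma box_max {k : ℕ} {lo hi : ℤ} (l u : Fin k → ℤ) (g h : Col k lo hi)
    (hh : inBox l u h) (hg : h ≤ g) :
    ∃ f : Col k lo hi, inBox l u f ∧ f ≤ g ∧ ∀ e, inBox l u e → e ≤ g → e ≤ f := by
  classical
  obtain ⟨f, hf⟩ := (Set.toFinite {e : Col k lo hi | inBox l u e ∧ e ≤ g}).exists_maximal
    ⟨h, hh, hg⟩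
  refine ⟨f, hf.prop.1, hf.prop.2, fun e he heg => ?_⟩
  have hem := mem_antiSeqs.1 e.2
  have hfm := mem_antiSeqs.1 f.2
  let w : Col k lo hi := ⟨fun i => max (e.1 i) (f.1 i), by
    rw [mem_antiSeqs]
    exact ⟨fun s => ⟨le_max_of_le_left (hem.1 s).1, max_le (hem.1 s).2 (hfm.1 s).2⟩,
      fun s t hst => max_lt_max (hem.2 hst) (hfm.2 hst)⟩⟩
  have hw : w ∈ {e : Col k lo hi | inBox l u e ∧ e ≤ g} :=
    ⟨fun i => ⟨le_max_of_le_left (he i).1, max_le (he i).2 (hf.prop.1 i).2⟩,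
      fun i => max_le (heg i) (hf.prop.2 i)⟩
  have h1 : f ≤ w := fun i => le_max_right _ _
  have h2 : e ≤ w := fun i => le_max_left _ _
  exact h2.trans (hf.2 hw h1)

/-- polynomials with nonnegative coefficients representing a function on `n ≥ 1` -/
def NonnegPoly (F : ℕ → ℚ) : Prop :=
  ∃ p : ℚ[X], (∀ i, 0 ≤ p.coeff i) ∧ ∀ n : ℕ, 1 ≤ n → p.eval (n : ℚ) = F n

lemma NonnegPoly.mul {F G : ℕ → ℚ} (hF : NonnegPoly F) (hG : NonnegPoly G) :
    NonnegPoly (fun n => F n * G n) := by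
  obtain ⟨p, hp, hp'⟩ := hF
  obtain ⟨q, hq, hq'⟩ := hG
  refine ⟨p * q, fun i => ?_, fun n hn => by rw [eval_mul, hp' n hn, hq' n hn]⟩
  rw [coeff_mul]
  exact Finset.sum_nonneg fun x _ => mul_nonneg (hp _) (hq _)

lemma NonnegPoly.sum {ι : Type*} (s : Finset ι) {F : ι → ℕ → ℚ}
    (hF : ∀ i, NonnegPoly (F i)) : NonnegPoly (fun n => ∑ i ∈ s, F i n) := by
  choose p hp hp' using hF
  refine ⟨∑ i ∈ s, p i, fun j => ?_, fun n hn => ?_⟩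
  · rw [finsetSum_coeff]; exact Finset.sum_nonneg fun x _ => hp _ _
  · rw [eval_finsetSum]; exact Finset.sum_congr rfl fun i _ => hp' i n hn

lemma stepMat_poly {k : ℕ} {lo hi : ℤ} (l u : Fin k → ℤ) (h g : Col k lo hi) :
    NonnegPoly (fun n => (stepMat (inBox l u) ^ n) h g) := by
  classical
  by_cases hh : inBox l u h
  · by_cases hex : ∃ e, inBox l u e ∧ e ≤ g
    · obtain ⟨e, he, heg⟩ := hex
      obtain ⟨f, hf, hfg, hmax⟩ := box_max l u g e he heg
      refine ⟨krewDet h.1 f.1, fun j => krewDet_coeff_nonneg k lo hi j h f, fun n hn => ?_⟩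
      obtain ⟨n, rfl⟩ := Nat.exists_eq_add_of_le' hn
      beta_reduce
      rw [← zetaMat_pow, ← stepMat_pow_mem l u (n + 1) h f hh hf, pow_succ, Matrix.mul_apply,
        Matrix.mul_apply]
      apply Finset.sum_congr rfl
      intro K _
      congr 1
      simp only [stepMat, Matrix.of_apply]
      have : (inBox l u K ∧ K ≤ f) ↔ (inBox l u K ∧ K ≤ g) :=
        ⟨fun h => ⟨h.1, h.2.trans hfg⟩, fun h => ⟨h.1, hmax K h.1 h.2⟩⟩
      simp only [this]
    · refine ⟨0, by simp, fun n hn => ?_⟩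
      obtain ⟨n, rfl⟩ := Nat.exists_eq_add_of_le' hn
      beta_reduce
      rw [pow_succ, Matrix.mul_apply, Finset.sum_eq_zero, eval_zero]
      intro K _
      have : ¬ (inBox l u K ∧ K ≤ g) := fun h => hex ⟨K, h⟩
      simp [stepMat, this]
  · refine ⟨0, by simp, fun n hn => ?_⟩
    obtain ⟨n, rfl⟩ := Nat.exists_eq_add_of_le' hn
    beta_reduce
    rw [pow_succ', Matrix.mul_apply, Finset.sum_eq_zero, eval_zero]
    intro K _
    simp [stepMat, hh]

/-- chains of columns -/
abbrev ChainSet {k : ℕ} {lo hi : ℤ} (B : ℕ → Col k lo hi → Prop) (M : ℕ) (g : Col k lo hi) :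
    Type :=
  {e : Fin M → Col k lo hi // Monotone e ∧ ∀ c : Fin M, B c (e c) ∧ e c ≤ g}

lemma chain_sigma_ext {k : ℕ} {lo hi : ℤ} {B : ℕ → Col k lo hi → Prop} {M : ℕ}
    {g : Col k lo hi} (p q : Σ h : {h : Col k lo hi // B M h ∧ h ≤ g}, ChainSet B M h.1)
    (h1 : p.1.1 = q.1.1) (h2 : p.2.1 = q.2.1) : p = q := by
  obtain ⟨⟨h, hh⟩, ⟨e, he⟩⟩ := p
  obtain ⟨⟨h', hh'⟩, ⟨e', he'⟩⟩ := q
  simp only at h1 h2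
  subst h1
  subst h2
  rfl

def chainEquiv {k : ℕ} {lo hi : ℤ} (B : ℕ → Col k lo hi → Prop) (M : ℕ) (g : Col k lo hi) :
    ChainSet B (M + 1) g ≃ Σ h : {h : Col k lo hi // B M h ∧ h ≤ g}, ChainSet B M h.1 where
  toFun e := ⟨⟨e.1 (Fin.last M), by simpa using e.2.2 (Fin.last M)⟩,
    ⟨fun c => e.1 c.castSucc, fun _ _ h => e.2.1 (Fin.castSucc_le_castSucc_iff.2 h), fun c =>
      ⟨by simpa using (e.2.2 c.castSucc).1, e.2.1 (Fin.le_last _)⟩⟩⟩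
  invFun p := ⟨Fin.snoc (α := fun _ => Col k lo hi) p.2.1 p.1.1, by
    obtain ⟨⟨h, h1, h2⟩, ⟨e, he, he'⟩⟩ := p
    constructor
    · intro s t hst
      induction t using Fin.lastCases with
      | last =>
        induction s using Fin.lastCases with
        | last => exact le_rfl
        | cast s => simpa using (he' s).2
      | cast t =>
        induction s using Fin.lastCases with
        | last => exact absurd (lt_of_lt_of_le (Fin.castSucc_lt_last t) hst) (lt_irrefl _)
        | cast s => simpa using he (Fin.castSucc_le_castSucc_iff.1 hst)
    · intro c
      induction c using Fin.lastCases with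
      | last => simpa using ⟨h1, h2⟩
      | cast c => simpa using ⟨(he' c).1, (he' c).2.trans h2⟩⟩
  left_inv e := by
    apply Subtype.ext
    funext c
    induction c using Fin.lastCases <;> simp
  right_inv p := by
    apply chain_sigma_ext
    · simp
    · funext c
      simp

lemma chain_card_succ {k : ℕ} {lo hi : ℤ} (B : ℕ → Col k lo hi → Prop) (M : ℕ)
    (g : Col k lo hi) :
    (Nat.card (ChainSet B (M + 1) g) : ℚ) =
      ∑ h, (Nat.card (ChainSet B M h) : ℚ) * stepMat (B M) h g := by
  classical
  rw [Nat.card_congr (chainEquiv B M g), Nat.card_sigma]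
  push_cast
  have h1 : ∀ h, (Nat.card (ChainSet B M h) : ℚ) * stepMat (B M) h g =
      if B M h ∧ h ≤ g then (Nat.card (ChainSet B M h) : ℚ) else 0 := by
    intro h
    simp [stepMat]
  simp only [h1]
  rw [← Finset.sum_filter]
  exact (Finset.sum_subtype (Finset.univ.filter fun h => B M h ∧ h ≤ g) (by simp)
    (fun h => (Nat.card (ChainSet B M h) : ℚ))).symm

lemma chain_card_add {k : ℕ} {lo hi : ℤ} (B : ℕ → Col k lo hi → Prop)
    (B0 : Col k lo hi → Prop) (M j : ℕ) (hB : ∀ i < j, B (M + i) = B0)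
    (g : Col k lo hi) :
    (Nat.card (ChainSet B (M + j) g) : ℚ) =
      ∑ h, (Nat.card (ChainSet B M h) : ℚ) * (stepMat B0 ^ j) h g := by
  classical
  induction j generalizing g with
  | zero => simp [Matrix.one_apply]
  | succ j ih =>
    have h1 := chain_card_succ B (M + j) g
    rw [← add_assoc, h1, hB j (by omega)]
    simp only [ih (fun i hi => hB i (by omega)), pow_succ, Matrix.mul_apply, Finset.sum_mul,
      Finset.mul_sum]
    rw [Finset.sum_comm]
    simp only [mul_assoc]

lemma chain_poly {k : ℕ} {lo hi : ℤ} (l u : ℕ → Fin k → ℤ) (N : ℕ) (g : Col k lo hi) :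
    NonnegPoly (fun n => (Nat.card (ChainSet (fun C => inBox (l (C / n)) (u (C / n)))
      (N * n) g) : ℚ)) := by
  induction N generalizing g with
  | zero =>
    refine ⟨1, fun i => by rw [coeff_one]; split_ifs <;> norm_num, fun n hn => ?_⟩
    have : Nat.card (ChainSet (fun C => inBox (lo := lo) (hi := hi) (l (C / n)) (u (C / n)))
      (0 * n) g) = 1 := by
      rw [zero_mul, Nat.card_eq_one_iff_unique]
      refine ⟨⟨fun a b => Subtype.ext (Subsingleton.elim _ _)⟩, ⟨⟨fun c => c.elim0, ?_, ?_⟩⟩⟩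
      · intro c; exact c.elim0
      · intro c; exact c.elim0
    beta_reduce
    rw [this]; simp
  | succ N ih =>
    have := NonnegPoly.sum Finset.univ fun h => (ih h).mul (stepMat_poly (l N) (u N) h g)
    obtain ⟨p, hp, hp'⟩ := this
    refine ⟨p, hp, fun n hn => ?_⟩
    rw [hp' n hn]
    beta_reduce
    rw [add_mul, one_mul]
    refine (chain_card_add _ (inBox (l N) (u N)) (N * n) n (fun i hi => ?_) g).symm
    have : (N * n + i) / n = N := by
      rw [mul_comm, Nat.mul_add_div (by omega), Nat.div_eq_of_lt hi, add_zero]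
    simp only [this]


/-- boundary-extended pattern, indexed by natural numbers -/
def exN {k m : ℕ} (Z Y : Fin k → ℕ) (x : Fin k → Fin m → ℤ) (i : Fin k) (j : ℕ) : ℤ :=
  if j = 0 then (Z i : ℤ) else if h : j - 1 < m then x i ⟨j - 1, h⟩ else (Y i : ℤ)

structure FaceCond {k m : ℕ} (Z Y a b : Fin k → ℕ) (x : Fin k → Fin m → ℤ) : Prop where
  p1 : ∀ i j, j ≤ m → exN Z Y x i j ≤ exN Z Y x i (j + 1)
  p2 : ∀ (i : Fin k) (hi : (i : ℕ) + 1 < k) (j : ℕ), j ≤ m →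
    exN Z Y x i (j + 1) ≤ exN Z Y x ⟨(i : ℕ) + 1, hi⟩ j
  p3 : ∀ i j, j ≤ m → (j + 1 ≤ a i ∨ b i < j + 1) → exN Z Y x i (j + 1) = exN Z Y x i j

def boxL (k m : ℕ) (Z Y a : Fin k → ℕ) (C : ℕ) (i : Fin k) : ℤ :=
  if C < Z i then -(i : ℤ) else if C < Y i then (a i : ℤ) + 1 else (m : ℤ) + 1 + k - i

def boxU (k m : ℕ) (Z Y b : Fin k → ℕ) (C : ℕ) (i : Fin k) : ℤ :=
  if C < Z i then -(i : ℤ) else if C < Y i then (b i : ℤ) else (m : ℤ) + 1 + k - i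

lemma exN_top {k m : ℕ} (Z Y : Fin k → ℕ) (x : Fin k → Fin m → ℤ) (i : Fin k) (j : ℕ)
    (hj : m + 1 ≤ j) : exN Z Y x i j = Y i := by
  unfold exN
  rw [if_neg (by omega), dif_neg (by omega)]

lemma exN_zero {k m : ℕ} (Z Y : Fin k → ℕ) (x : Fin k → Fin m → ℤ) (i : Fin k) :
    exN Z Y x i 0 = Z i := by simp [exN]

lemma exN_mid {k m : ℕ} (Z Y : Fin k → ℕ) (x : Fin k → Fin m → ℤ) (i : Fin k) (j : Fin m) :
    exN Z Y x i (j + 1) = x i j := by simp [exN]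

lemma FaceCond.mono {k m : ℕ} {Z Y a b : Fin k → ℕ} {x : Fin k → Fin m → ℤ}
    (h : FaceCond Z Y a b x) (i : Fin k) : Monotone (exN Z Y x i) := by
  apply monotone_nat_of_le_succ
  intro j
  by_cases hj : j ≤ m
  · exact h.p1 i j hj
  · rw [exN_top _ _ _ _ _ (by omega), exN_top _ _ _ _ _ (by omega)]

lemma FaceCond.low {k m : ℕ} {Z Y a b : Fin k → ℕ} {x : Fin k → Fin m → ℤ}
    (h : FaceCond Z Y a b x) (i : Fin k) (j : ℕ) (hj : j ≤ a i) (hm : j ≤ m + 1) :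
    exN Z Y x i j = Z i := by
  induction j with
  | zero => exact exN_zero _ _ _ _
  | succ j ih => rw [h.p3 i j (by omega) (Or.inl hj), ih (by omega) (by omega)]

lemma FaceCond.high {k m : ℕ} {Z Y a b : Fin k → ℕ} {x : Fin k → Fin m → ℤ}
    (h : FaceCond Z Y a b x) (i : Fin k) (d j : ℕ) (hj : b i ≤ j) (hm : j + d = m + 1) :
    exN Z Y x i j = Y i := by
  induction d generalizing j with
  | zero => exact exN_top _ _ _ _ _ (by omega)
  | succ d ih =>
    rw [← h.p3 i j (by omega) (Or.inr (by omega)), ih (j + 1) (by omega) (by omega)]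

noncomputable def rowCnt {k m : ℕ} (Z Y : Fin k → ℕ) (x : Fin k → Fin m → ℤ) (C : ℕ)
    (i : Fin k) : ℕ :=
  ((Finset.range (m + 1)).filter fun j => exN Z Y x i j ≤ (C : ℤ)).card

lemma rowCnt_le {k m : ℕ} {Z Y a b : Fin k → ℕ} {x : Fin k → Fin m → ℤ}
    (h : FaceCond Z Y a b x) (i : Fin k) (C : ℕ) (hC : C < Y i) (j : ℕ) :
    rowCnt Z Y x C i ≤ j ↔ (C : ℤ) < exN Z Y x i j := by
  constructor
  · intro hle
    by_contra hlt
    push Not at hlt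
    have hj : j < m + 1 := by
      by_contra hj
      rw [exN_top _ _ _ _ _ (by omega)] at hlt
      omega
    have : Finset.range (j + 1) ⊆
        (Finset.range (m + 1)).filter fun j => exN Z Y x i j ≤ (C : ℤ) := by
      intro t ht
      rw [Finset.mem_range] at ht
      rw [Finset.mem_filter, Finset.mem_range]
      exact ⟨by omega, (h.mono i (by omega : t ≤ j)).trans hlt⟩
    have := Finset.card_le_card this
    rw [Finset.card_range] at this
    unfold rowCnt at hle
    omega
  · intro hlt
    have : ((Finset.range (m + 1)).filter fun j => exN Z Y x i j ≤ (C : ℤ)) ⊆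
        Finset.range j := by
      intro t ht
      rw [Finset.mem_filter] at ht
      rw [Finset.mem_range]
      by_contra htj
      have := h.mono i (by omega : j ≤ t)
      omega
    have := Finset.card_le_card this
    rw [Finset.card_range] at this
    exact this

noncomputable def colOf {k m : ℕ} (Z Y : Fin k → ℕ) (x : Fin k → Fin m → ℤ) (C : ℕ)
    (i : Fin k) : ℤ :=
  if C < Z i then -(i : ℤ) else if C < Y i then (rowCnt Z Y x C i : ℤ) else (m : ℤ) + 1 + k - i

lemma FaceCond.bounds {k m : ℕ} {Z Y a b : Fin k → ℕ} {x : Fin k → Fin m → ℤ}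
    (h : FaceCond Z Y a b x) (i : Fin k) (j : ℕ) :
    (Z i : ℤ) ≤ exN Z Y x i j ∧ exN Z Y x i j ≤ Y i := by
  constructor
  · rw [← exN_zero Z Y x i]; exact h.mono i (Nat.zero_le j)
  · rw [← exN_top Z Y x i (m + 1 + j) (by omega)]; exact h.mono i (by omega)

lemma colOf_le {k m : ℕ} {Z Y a b : Fin k → ℕ} {x : Fin k → Fin m → ℤ}
    (h : FaceCond Z Y a b x) (i : Fin k) (C : ℕ) (j : ℕ) (hj : j ≤ m + 1) :
    colOf Z Y x C i ≤ (j : ℤ) ↔ (C : ℤ) < exN Z Y x i j := by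
  have hb := h.bounds i j
  unfold colOf
  split_ifs with h1 h2
  · constructor <;> intro <;> omega
  · rw [Nat.cast_le]; exact rowCnt_le h i C h2 j
  · have := i.isLt
    constructor <;> intro <;> omega

lemma colOf_anti {k m : ℕ} {Z Y a b : Fin k → ℕ} {x : Fin k → Fin m → ℤ}
    (h : FaceCond Z Y a b x) (hZ : Monotone Z) (hY : Monotone Y) (C : ℕ) :
    StrictAnti (colOf Z Y x C) := by
  have step : ∀ (i : Fin k) (hi : (i : ℕ) + 1 < k),
      colOf Z Y x C ⟨(i : ℕ) + 1, hi⟩ < colOf Z Y x C i := by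
    intro i hi
    have hZi : Z i ≤ Z ⟨(i : ℕ) + 1, hi⟩ := hZ (by simp [Fin.le_def])
    have hYi : Y i ≤ Y ⟨(i : ℕ) + 1, hi⟩ := hY (by simp [Fin.le_def])
    by_cases h1 : C < Z i
    · unfold colOf
      rw [if_pos h1, if_pos (by omega)]
      push_cast; omega
    by_cases h2 : C < Y i
    · have e : colOf Z Y x C i = (rowCnt Z Y x C i : ℤ) := by
        unfold colOf; rw [if_neg h1, if_pos h2]
      obtain ⟨r, hr⟩ : ∃ r, rowCnt Z Y x C i = r + 1 := by
        refine Nat.exists_eq_succ_of_ne_zero ?_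
        intro h0
        have := (rowCnt_le h i C h2 0).1 (by omega)
        rw [exN_zero] at this
        omega
      have hle : rowCnt Z Y x C i ≤ m + 1 := by
        rw [rowCnt_le h i C h2, exN_top _ _ _ _ _ le_rfl]; exact_mod_cast h2
      have hlt := (rowCnt_le h i C h2 (r + 1)).1 (by omega)
      have h3 := h.p2 i hi r (by omega)
      have := (colOf_le h ⟨(i : ℕ) + 1, hi⟩ C r (by omega)).2 (by omega)
      rw [e, hr]
      push_cast
      omega
    · have e : colOf Z Y x C i = (m : ℤ) + 1 + k - i := by
        unfold colOf; rw [if_neg h1, if_neg h2]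
      rw [e]
      by_cases h3 : C < Y ⟨(i : ℕ) + 1, hi⟩
      · have := (colOf_le h ⟨(i : ℕ) + 1, hi⟩ C (m + 1) le_rfl).2
          (by rw [exN_top _ _ _ _ _ le_rfl]; exact_mod_cast h3)
        push_cast at this
        omega
      · unfold colOf
        have hb := (h.bounds ⟨(i : ℕ) + 1, hi⟩ 0)
        rw [if_neg (by omega), if_neg h3]
        push_cast
        omega
  intro s t hst
  obtain ⟨s, hs⟩ := s
  obtain ⟨t, ht⟩ := t
  have hst' : s < t := hst
  obtain ⟨d, rfl⟩ := Nat.exists_eq_add_of_lt hst'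
  clear hst hst'
  induction d with
  | zero => exact step ⟨s, hs⟩ ht
  | succ d ih => exact (step ⟨s + d + 1, by omega⟩ ht).trans (ih (by omega))

lemma colOf_mono {k m : ℕ} {Z Y a b : Fin k → ℕ} {x : Fin k → Fin m → ℤ}
    (h : FaceCond Z Y a b x) {C C' : ℕ} (hC : C ≤ C') (i : Fin k) :
    colOf Z Y x C i ≤ colOf Z Y x C' i := by
  by_cases h1 : C' < Z i
  · unfold colOf; rw [if_pos h1, if_pos (by omega)]
  by_cases h2 : C' < Y i
  · have e : colOf Z Y x C' i = (rowCnt Z Y x C' i : ℤ) := by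
      unfold colOf; rw [if_neg h1, if_pos h2]
    have hlt := (rowCnt_le h i C' h2 _).1 le_rfl
    have hle : rowCnt Z Y x C' i ≤ m + 1 := by
        rw [rowCnt_le h i C' h2, exN_top _ _ _ _ _ le_rfl]; exact_mod_cast h2
    rw [e, colOf_le h i C _ hle]
    omega
  · have e : colOf Z Y x C' i = (m : ℤ) + 1 + k - i := by
      unfold colOf; rw [if_neg h1, if_neg h2]
    rw [e]
    by_cases h3 : C < Y i
    · have := (colOf_le h i C (m + 1) le_rfl).2
          (by rw [exN_top _ _ _ _ _ le_rfl]; exact_mod_cast h3)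
      push_cast at this
      have := i.isLt
      omega
    · unfold colOf
      have hb := (h.bounds i 0)
      rw [if_neg (by omega), if_neg h3]

lemma colOf_box {k m : ℕ} {Z Y a b : Fin k → ℕ} {x : Fin k → Fin m → ℤ}
    (h : FaceCond Z Y a b x) (hab : ∀ i, a i < b i) (hbm : ∀ i, b i ≤ m + 1) (C : ℕ) (i : Fin k) :
    boxL k m Z Y a C i ≤ colOf Z Y x C i ∧ colOf Z Y x C i ≤ boxU k m Z Y b C i := by
  unfold boxL boxU colOf
  have := hab i
  have := hbm i
  split_ifs with h1 h2
  · exact ⟨le_rfl, le_rfl⟩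
  · constructor
    · by_contra hlt
      have := (rowCnt_le h i C h2 (a i)).1 (by omega)
      rw [h.low i (a i) le_rfl (by omega)] at this
      omega
    · rw [Nat.cast_le, rowCnt_le h i C h2, h.high i (m + 1 - b i) (b i) le_rfl (by omega)]
      exact_mod_cast h2
  · exact ⟨le_rfl, le_rfl⟩

def topCol (k m : ℕ) : Col k (-(k : ℤ)) ((m : ℤ) + 1 + k) :=
  ⟨fun i => (m : ℤ) + 1 + k - i, by
    rw [mem_antiSeqs]
    refine ⟨fun i => ?_, fun i j hij => ?_⟩
    · have := i.isLt
      constructor <;> omega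
    · have : (i : ℕ) < j := hij
      simp only; omega⟩

lemma box_range {k m : ℕ} {Z Y a b : Fin k → ℕ} (hbm : ∀ i, b i ≤ m + 1)
    (C : ℕ) (i : Fin k) :
    -(k : ℤ) ≤ boxL k m Z Y a C i ∧ boxU k m Z Y b C i ≤ (m : ℤ) + 1 + k - i := by
  have := hbm i
  have := i.isLt
  unfold boxL boxU
  split_ifs <;> constructor <;> omega

abbrev GChain {k m : ℕ} (Z Y a b : Fin k → ℕ) (M : ℕ) : Type :=
  ChainSet (k := k) (lo := -(k : ℤ)) (hi := (m : ℤ) + 1 + k)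
    (fun C => inBox (boxL k m Z Y a C) (boxU k m Z Y b C)) M (topCol k m)

def Gal {k m : ℕ} (Z Y : Fin k → ℕ) (M : ℕ) (x : Fin k → Fin m → ℤ)
    (e : Fin M → Col k (-(k : ℤ)) ((m : ℤ) + 1 + k)) : Prop :=
  ∀ (C : Fin M) (i : Fin k) (j : ℕ), j ≤ m + 1 →
    ((e C).1 i ≤ (j : ℤ) ↔ ((C : ℕ) : ℤ) < exN Z Y x i j)

lemma exists_chain {k m : ℕ} {Z Y a b : Fin k → ℕ} {x : Fin k → Fin m → ℤ}
    (h : FaceCond Z Y a b x) (hZ : Monotone Z) (hY : Monotone Y)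
    (hab : ∀ i, a i < b i) (hbm : ∀ i, b i ≤ m + 1) (M : ℕ) :
    ∃ e : GChain (m := m) Z Y a b M, Gal Z Y M x e.1 := by
  have hbox := colOf_box h hab hbm
  have hr := fun C i => box_range (Z := Z) (Y := Y) (a := a) hbm C i
  refine ⟨⟨fun C => ⟨colOf Z Y x C, ?_⟩, ?_, ?_⟩, ?_⟩
  · rw [mem_antiSeqs]
    refine ⟨fun i => ?_, colOf_anti h hZ hY C⟩
    have h1 := hbox C i
    have h2 := hr C i
    constructor <;> omega
  · intro C C' hC i
    exact colOf_mono h hC i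
  · intro C
    refine ⟨fun i => hbox C i, fun i => ?_⟩
    exact (hbox C i).2.trans (hr C i).2
  · intro C i j hj
    exact colOf_le h i C j hj

lemma le_of_fin {M : ℕ} {u v : ℤ} (hu : u ≤ M) (hv : 0 ≤ v)
    (h : ∀ C : Fin M, ((C : ℕ) : ℤ) < u → ((C : ℕ) : ℤ) < v) : u ≤ v := by
  by_contra hlt
  push Not at hlt
  have := h ⟨v.toNat, by omega⟩ (by simp only; omega)
  simp only at this
  omega

lemma count_gal {M : ℕ} (f : Fin M → ℤ) (hf : Monotone f) (v : ℤ) (C : Fin M) :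
    (C : ℕ) < (Finset.univ.filter fun C' => f C' ≤ v).card ↔ f C ≤ v := by
  constructor
  · intro h
    by_contra hlt
    have : (Finset.univ.filter fun C' => f C' ≤ v) ⊆ Finset.Iio C := by
      intro t ht
      simp only [Finset.mem_filter, Finset.mem_univ, true_and] at ht
      rw [Finset.mem_Iio]
      by_contra htC
      exact hlt ((hf (not_lt.1 htC)).trans ht)
    have := Finset.card_le_card this
    rw [Fin.card_Iio] at this
    omega
  · intro h
    have : Finset.Iic C ⊆ (Finset.univ.filter fun C' => f C' ≤ v) := by
      intro t ht
      rw [Finset.mem_Iic] at ht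
      simp only [Finset.mem_filter, Finset.mem_univ, true_and]
      exact (hf ht).trans h
    have := Finset.card_le_card this
    rw [Fin.card_Iic] at this
    omega

lemma exists_pattern {k m : ℕ} {Z Y a b : Fin k → ℕ} {M : ℕ}
    (hZY : ∀ i, Z i ≤ Y i) (hYM : ∀ i, Y i ≤ M)
    (hab : ∀ i, a i < b i) (hbm : ∀ i, b i ≤ m + 1)
    (e : GChain (m := m) Z Y a b M) :
    ∃ x : Fin k → Fin m → ℤ, FaceCond Z Y a b x ∧ Gal Z Y M x e.1 := by
  obtain ⟨e, hmono, he⟩ := e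
  let x : Fin k → Fin m → ℤ := fun i j =>
    ((Finset.univ.filter fun C : Fin M => (e C).1 i ≤ ((j : ℕ) : ℤ) + 1).card : ℤ)
  have hb : ∀ C i, boxL k m Z Y a (C : Fin M) i ≤ (e C).1 i ∧ (e C).1 i ≤ boxU k m Z Y b C i :=
    fun C i => (he C).1 i
  have hG : Gal Z Y M x e := by
    intro C i j hj
    have h1 := hb C i
    have h2 := hZY i
    have h3 := hbm i
    have h4 := i.isLt
    unfold boxL boxU at h1
    rcases Nat.eq_zero_or_pos j with rfl | hj0
    · rw [exN_zero]
      split_ifs at h1 <;> constructor <;> intro <;> omega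
    by_cases hjm : j = m + 1
    · rw [exN_top _ _ _ _ _ (by omega)]
      split_ifs at h1 <;> constructor <;> intro <;> omega
    · obtain ⟨t, rfl⟩ := Nat.exists_eq_add_of_le' hj0
      have := exN_mid Z Y x i ⟨t, by omega⟩
      simp only at this
      rw [this]
      have h5 := count_gal (fun C => (e C).1 i) (fun C C' h => hmono h i) ((t : ℤ) + 1) C
      simp only [x]
      rw [Nat.cast_lt, h5]
      push_cast
      rfl
  have hbd : ∀ i j, 0 ≤ exN Z Y x i j ∧ exN Z Y x i j ≤ M := by
    intro i j
    have := hZY i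
    have := hYM i
    unfold exN
    split_ifs
    · constructor <;> omega
    · simp only [x]
      refine ⟨by positivity, ?_⟩
      rw [Nat.cast_le]
      exact (Finset.card_le_univ _).trans (by simp)
    · constructor <;> omega
  refine ⟨x, ⟨?_, ?_, ?_⟩, hG⟩
  · intro i j hj
    apply le_of_fin (hbd i j).2 (hbd i (j + 1)).1
    intro C hC
    rw [← hG C i _ (by omega)] at hC ⊢
    push_cast
    omega
  · intro i hi j hj
    apply le_of_fin (hbd i _).2 (hbd _ j).1
    intro C hC
    rw [← hG C _ _ (by omega)] at hC ⊢
    have hanti := (mem_antiSeqs.1 (e C).2).2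
    have : (e C).1 ⟨(i : ℕ) + 1, hi⟩ < (e C).1 i := hanti (by simp [Fin.lt_def])
    push_cast at hC
    omega
  · intro i j hj hcase
    have key : ∀ C : Fin M, (((C : ℕ) : ℤ) < exN Z Y x i (j + 1) ↔
        ((C : ℕ) : ℤ) < exN Z Y x i j) := by
      intro C
      rw [← hG C i _ (by omega), ← hG C i _ (by omega)]
      have h1 := hb C i
      have h2 := hbm i
      have h4 := i.isLt
      unfold boxL boxU at h1
      push_cast
      split_ifs at h1 <;> constructor <;> intro <;> omega
    exact le_antisymm (le_of_fin (hbd _ _).2 (hbd _ _).1 fun C => (key C).1)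
      (le_of_fin (hbd _ _).2 (hbd _ _).1 fun C => (key C).2)

lemma face_card {k m : ℕ} {Z Y a b : Fin k → ℕ} {M : ℕ}
    (hZ : Monotone Z) (hY : Monotone Y)
    (hZY : ∀ i, Z i ≤ Y i) (hYM : ∀ i, Y i ≤ M)
    (hab : ∀ i, a i < b i) (hbm : ∀ i, b i ≤ m + 1) :
    Nat.card {x : Fin k → Fin m → ℤ // FaceCond Z Y a b x} =
      Nat.card (GChain (m := m) Z Y a b M) := by
  choose f hf using fun x : {x : Fin k → Fin m → ℤ // FaceCond Z Y a b x} =>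
    exists_chain x.2 hZ hY hab hbm M
  apply Nat.card_eq_of_bijective f
  constructor
  · intro x x' hxx
    have h1 := hf x
    have h2 := hf x'
    rw [← hxx] at h2
    apply Subtype.ext
    funext i j
    rw [← exN_mid Z Y x.1 i j, ← exN_mid Z Y x'.1 i j]
    have b1 := x.2.bounds i (j + 1)
    have b2 := x'.2.bounds i (j + 1)
    have hM := hYM i
    have hj := j.isLt
    apply le_antisymm
    · refine le_of_fin (M := M) (by omega) (by omega) fun C hC => ?_
      rw [← h1 C i _ (by omega)] at hC
      rwa [← h2 C i _ (by omega)]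
    · refine le_of_fin (M := M) (by omega) (by omega) fun C hC => ?_
      rw [← h2 C i _ (by omega)] at hC
      rwa [← h1 C i _ (by omega)]
  · intro e
    obtain ⟨x, hx, hG⟩ := exists_pattern hZY hYM hab hbm e
    refine ⟨⟨x, hx⟩, ?_⟩
    have h1 := hf ⟨x, hx⟩
    generalize f ⟨x, hx⟩ = e' at h1
    apply Subtype.ext
    funext C
    apply Subtype.ext
    funext i
    have hb := (e.2.2 C).1 i
    have hb' := (e'.2.2 C).1 i
    have hbi := hbm i
    unfold boxL boxU at hb hb'
    have key : ∀ j : ℕ, j ≤ m + 1 → ((e.1 C).1 i ≤ (j : ℤ) ↔ (e'.1 C).1 i ≤ (j : ℤ)) :=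
      fun j hj => (hG C i j hj).trans (h1 C i j hj).symm
    split_ifs at hb hb'
    · omega
    · have k1 := key ((e.1 C).1 i).toNat (by omega)
      have k2 := key ((e'.1 C).1 i).toNat (by omega)
      omega
    · omega

lemma gtExt_eq_exN {k m : ℕ} (Z Y : Fin k → ℕ) (zt yt : Fin k → ℤ)
    (hz : ∀ i, zt i = Z i) (hy : ∀ i, yt i = Y i)
    (x : Fin k → Fin m → ℤ) (i : Fin k) (j : Fin (m + 2)) :
    gtExt k m zt yt x i j = exN Z Y x i (j : ℕ) := by
  have := j.isLt
  unfold gtExt exN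
  by_cases h0 : (j : ℕ) = 0
  · rw [dif_pos h0, if_pos h0, hz]
  · rw [dif_neg h0, if_neg h0]
    by_cases h1 : (j : ℕ) = m + 1
    · rw [dif_pos h1, dif_neg (by omega), hy]
    · rw [dif_neg h1, dif_pos (by omega)]

lemma face_iff {k m : ℕ} (Z Y a b : Fin k → ℕ) (zt yt : Fin k → ℤ)
    (hz : ∀ i, zt i = Z i) (hy : ∀ i, yt i = Y i) (x : Fin k → Fin m → ℤ) :
    (gtCond k m zt yt x ∧ ∀ (i : Fin k) (j : Fin (m + 1)),
      ((j : ℕ) + 1 ≤ a i ∨ b i < (j : ℕ) + 1) →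
        gtExt k m zt yt x i j.succ = gtExt k m zt yt x i j.castSucc) ↔
    FaceCond Z Y a b x := by
  unfold gtCond
  simp only [gtExt_eq_exN Z Y zt yt hz hy, Fin.val_succ, Fin.val_castSucc]
  constructor
  · rintro ⟨⟨h1, h2⟩, h3⟩
    exact ⟨fun i j hj => h1 i ⟨j, by omega⟩, fun i hi j hj => h2 i hi ⟨j, by omega⟩,
      fun i j hj => h3 i ⟨j, by omega⟩⟩
  · rintro ⟨h1, h2, h3⟩
    exact ⟨⟨fun i j => h1 i j (by omega), fun i hi j => h2 i hi j (by omega)⟩,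
      fun i j => h3 i j (by omega)⟩

lemma box_scale (n C t : ℕ) (hn : 1 ≤ n) : (C < n * t) = (C / n < t) := by
  rw [Nat.div_lt_iff_lt_mul (by omega), mul_comm]

lemma face_poly {k m : ℕ} (zt yt a b : Fin k → ℕ) (hz : Monotone zt) (hy : Monotone yt)
    (N : ℕ) (hN : ∀ i, yt i ≤ N)
    (hab : ∀ i, a i < b i) (hbm : ∀ i, b i ≤ m + 1) :
    NonnegPoly (fun n => (Nat.card {x : Fin k → Fin m → ℤ //
      FaceCond (fun i => n * zt i) (fun i => n * yt i) a b x} : ℚ)) := by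
  by_cases hzy : ∀ i, zt i ≤ yt i
  · obtain ⟨p, hp, hpe⟩ := chain_poly (boxL k m zt yt a) (boxU k m zt yt b) N (topCol k m)
    refine ⟨p, hp, fun n hn => ?_⟩
    rw [hpe n hn]
    have h := face_card (m := m) (Z := fun i => n * zt i) (Y := fun i => n * yt i)
      (a := a) (b := b) (M := N * n)
      (fun i j h => Nat.mul_le_mul_left n (hz h)) (fun i j h => Nat.mul_le_mul_left n (hy h))
      (fun i => Nat.mul_le_mul_left n (hzy i))
      (fun i => by rw [mul_comm N]; exact Nat.mul_le_mul_left n (hN i)) hab hbm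
    simp only []
    rw [h]
    have e1 : ∀ C, boxL k m (fun i => n * zt i) (fun i => n * yt i) a C
        = boxL k m zt yt a (C / n) := by
      intro C; funext i; simp only [boxL, box_scale n C _ hn]
    have e2 : ∀ C, boxU k m (fun i => n * zt i) (fun i => n * yt i) b C
        = boxU k m zt yt b (C / n) := by
      intro C; funext i; simp only [boxU, box_scale n C _ hn]
    unfold GChain
    simp only [e1, e2]
  · refine ⟨0, by simp, fun n hn => ?_⟩
    push Not at hzy
    obtain ⟨i, hi⟩ := hzy
    have : IsEmpty {x : Fin k → Fin m → ℤ //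
        FaceCond (fun i => n * zt i) (fun i => n * yt i) a b x} := by
      refine ⟨fun x => ?_⟩
      have h := x.2.bounds i 0
      have h2 := h.1.trans h.2
      have h3 : n * zt i ≤ n * yt i := by exact_mod_cast h2
      have := Nat.le_of_mul_le_mul_left h3 (by omega)
      omega
    simp

end Helpers

/-- **Theorem.** Let `a, b ∈ ℤ^k` be weakly increasing with `0 ≤ a_i < b_i ≤ m + 1`
and let `F` be the face of the skew Gelfand–Tsetlin polytope `GT_k^m(y, z)` cut out
by the equalities `x_{i,j} = x_{i,j−1}` for all `i ∈ [k]` and `j ∈ [m+1]` with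
`j ∉ [a_i + 1, b_i]` (with `x_{i,0} = z̃_i`, `x_{i,m+1} = ỹ_i`); its lattice points
are the flagged semi-standard Young tableaux.  Then `F` is Ehrhart positive: there
is a polynomial `p ∈ ℚ[n]` with nonnegative coefficients such that for all `n ≥ 1`,
`p(n)` is the number of integer points of the face of `GT_k^m(ny, nz)` cut out by
the same equalities. -/
theorem flagged_gelfandTsetlin_face_ehrhart_positivity
    (k m : ℕ) (hk : 0 < k) (hm : 0 < m) (y z : Fin k → ℕ)
    (a b : Fin k → ℕ) (ha : Monotone a) (hb : Monotone b)
    (hab : ∀ i, a i < b i) (hbm : ∀ i, b i ≤ m + 1) :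
    ∃ p : Polynomial ℚ, (∀ i : ℕ, 0 ≤ p.coeff i) ∧
      ∀ n : ℕ, 1 ≤ n →
        p.eval (n : ℚ) =
          Nat.card {x : Fin k → Fin m → ℤ //
            gtCond k m
              (fun i => (n : ℤ) * ∑ l ∈ Finset.Iic i, (z l : ℤ))
              (fun i => (n : ℤ) * ∑ l ∈ Finset.Iic i, (y l : ℤ)) x ∧
            ∀ (i : Fin k) (j : Fin (m + 1)),
              ((j : ℕ) + 1 ≤ a i ∨ b i < (j : ℕ) + 1) →
              gtExt k m
                (fun i => (n : ℤ) * ∑ l ∈ Finset.Iic i, (z l : ℤ))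
                (fun i => (n : ℤ) * ∑ l ∈ Finset.Iic i, (y l : ℤ)) x i j.succ =
              gtExt k m
                (fun i => (n : ℤ) * ∑ l ∈ Finset.Iic i, (z l : ℤ))
                (fun i => (n : ℤ) * ∑ l ∈ Finset.Iic i, (y l : ℤ)) x i j.castSucc} := by
  have mono : ∀ w : Fin k → ℕ, Monotone (fun i : Fin k => ∑ l ∈ Finset.Iic i, w l) :=
    fun w i j h => Finset.sum_le_sum_of_subset (Finset.Iic_subset_Iic.2 h)
  obtain ⟨p, hp, hpe⟩ := face_poly (m := m) (fun i => ∑ l ∈ Finset.Iic i, z l)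
    (fun i => ∑ l ∈ Finset.Iic i, y l) a b (mono z) (mono y) (∑ l, y l)
    (fun i => Finset.sum_le_sum_of_subset (Finset.subset_univ _)) hab hbm
  refine ⟨p, hp, fun n hn => ?_⟩
  rw [hpe n hn]
  beta_reduce
  congr 1
  apply Nat.card_congr
  apply Equiv.subtypeEquivRight
  intro x
  exact (face_iff _ _ a b _ _ (fun i => by push_cast; rfl) (fun i => by push_cast; rfl) x).symm
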